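/- Let τ be a semistandard Young tableau of shape λ and weight μ, let B ∈ X̊_{τ−[m]}, and let S = (B^{λ_r−1})^{-1}(Im B^{λ_r}) = { v ∈ ℂ^{N−1} : B^{λ_r−1} v ∈ Im(B^{λ_r}) }. Then dim_ℂ S = N − r and dim_ℂ (S ∩ L) = m − r. -/

import Mathlib

open scoped BigOperators Classical

noncomputable section

namespace Gov

/-- Extend a vector of length `m` by zeros. -/
def ext {m : ℕ} (f : Fin m → ℕ) : ℕ → ℕ := fun r => if h : r < m then f ⟨r, h⟩ else 0

/-- Offset of the `a`-th block: `μ_1 + ⋯ + μ_{a-1}`. -/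
def off {m : ℕ} (μ : Fin m → ℕ) (a : Fin m) : ℕ :=
  ∑ j ∈ Finset.univ.filter (fun j : Fin m => (j : ℕ) < (a : ℕ)), μ j

/-- Total entry access for a square matrix (zero outside the index range). -/
def ent {N : ℕ} (A : Matrix (Fin N) (Fin N) ℂ) (i j : ℕ) : ℂ :=
  if h : i < N ∧ j < N then A ⟨i, h.1⟩ ⟨j, h.2⟩ else 0

/-- Entries of the Jordan matrix `J_μ`:  `J_μ e_a^b = e_a^{b-1}`. -/
def Jent {m : ℕ} (μ : Fin m → ℕ) (i j : ℕ) : ℂ :=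
  if ∃ a : Fin m, ∃ b : ℕ, b + 1 < μ a ∧ i = off μ a + b ∧ j = off μ a + b + 1 then 1 else 0

/-- Membership in the Mirković–Vybornov slice `T_μ`. -/
def inSlice {m N : ℕ} (μ : Fin m → ℕ) (A : Matrix (Fin N) (Fin N) ℂ) : Prop :=
  ∀ s a : Fin m, ∀ t b : ℕ, t < μ s → b < μ a →
    (t + 1 < μ s ∨ (t + 1 = μ s ∧ μ s ≤ b)) →
    ent A (off μ s + t) (off μ a + b) = Jent μ (off μ s + t) (off μ a + b)

/-- Upper triangularity. -/
def upperTri {N : ℕ} (A : Matrix (Fin N) (Fin N) ℂ) : Prop :=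
  ∀ i j : Fin N, (j : ℕ) < (i : ℕ) → A i j = 0

/-- The top-left `d × d` submatrix. -/
def corner {N : ℕ} (A : Matrix (Fin N) (Fin N) ℂ) (d : ℕ) : Matrix (Fin d) (Fin d) ℂ :=
  fun i j => ent A (i : ℕ) (j : ℕ)

/-- `A` is nilpotent with Jordan type `κ` (a partition with at most `rows` parts):
`rank A^k = Σ_r max(κ_r − k, 0)` for all `k ≥ 1`. -/
def hasType {n : ℕ} (A : Matrix (Fin n) (Fin n) ℂ) (rows : ℕ) (κ : ℕ → ℕ) : Prop :=
  ∀ k : ℕ, 1 ≤ k → (A ^ k).rank = ∑ r ∈ Finset.range rows, (κ r - k)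

/-- A semistandard Young tableau of shape `lam` and weight `μ`, both with at most `m` parts,
with entries in `{1, …, m}` (rows and columns are 0-based; `entry r c = 0` outside the shape). -/
structure Tableau (m : ℕ) (lam μ : Fin m → ℕ) where
  entry : ℕ → ℕ → ℕ
  zeros : ∀ r c : ℕ, ¬ c < ext lam r → entry r c = 0
  entry_pos : ∀ r c : ℕ, c < ext lam r → 1 ≤ entry r c
  entry_le : ∀ r c : ℕ, c < ext lam r → entry r c ≤ m
  row_weak : ∀ r c c' : ℕ, c ≤ c' → c' < ext lam r → entry r c ≤ entry r c'
  col_strict : ∀ r r' c : ℕ, r < r' → c < ext lam r' → entry r c < entry r' c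
  weight : ∀ i : Fin m,
    (∑ r ∈ Finset.range m,
      ((Finset.range (ext lam r)).filter fun c => entry r c = (i : ℕ) + 1).card) = μ i

/-- Row lengths of the shape `λ^{(i)}` of the tableau obtained from `T` by deleting all
entries `> i` (here `i` is 1-based). -/
def shapeRow {m : ℕ} {lam μ : Fin m → ℕ} (T : Tableau m lam μ) (i : ℕ) : ℕ → ℕ :=
  fun r => ((Finset.range (ext lam r)).filter fun c => 1 ≤ T.entry r c ∧ T.entry r c ≤ i).card

/-- Row lengths of the shape `λ^{(i,k)}` of the tableau obtained from `T` by deleting all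
entries `> i` and all but the leftmost `k` entries equal to `i` (here `i` is 1-based). -/
def shapeRowBox {m : ℕ} {lam μ : Fin m → ℕ} (T : Tableau m lam μ) (i k : ℕ) : ℕ → ℕ :=
  fun r => ((Finset.range (ext lam r)).filter fun c =>
    (1 ≤ T.entry r c ∧ T.entry r c < i) ∨ (T.entry r c = i ∧
      ((Finset.range c).filter fun c' => ∃ r' < m, T.entry r' c' = i).card < k)).card

/-- The matrix variety `X̊_τ`. -/
def Xcirc {m : ℕ} (μ lam : Fin m → ℕ) (N : ℕ) (T : Tableau m lam μ) :
    Set (Matrix (Fin N) (Fin N) ℂ) :=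
  { A | inSlice μ A ∧ upperTri A ∧
      ∀ i : Fin m, hasType (corner A (off μ i + μ i)) m (shapeRow T ((i : ℕ) + 1)) }

/-- The Zariski topology on `N × N` complex matrices: closed sets are common zero sets of
families of polynomials in the entries. -/
def mzar (N : ℕ) : TopologicalSpace (Matrix (Fin N) (Fin N) ℂ) :=
  TopologicalSpace.generateFrom
    { U | ∃ p : MvPolynomial (Fin N × Fin N) ℂ,
        U = { A | MvPolynomial.eval (fun q => A q.1 q.2) p ≠ 0 } }

/-- Zariski closure. -/
def closureZ {N : ℕ} (S : Set (Matrix (Fin N) (Fin N) ℂ)) : Set (Matrix (Fin N) (Fin N) ℂ) :=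
  letI := mzar N
  closure S

/-- Irreducibility for the Zariski topology. -/
def isIrreducibleZ {N : ℕ} (S : Set (Matrix (Fin N) (Fin N) ℂ)) : Prop :=
  letI := mzar N
  IsIrreducible S

/-- Irreducible components of a subset: maximal irreducible subsets. -/
def irrCompsZ {N : ℕ} (S : Set (Matrix (Fin N) (Fin N) ℂ)) :
    Set (Set (Matrix (Fin N) (Fin N) ℂ)) :=
  { C | C ⊆ S ∧ isIrreducibleZ C ∧
      ∀ C', C' ⊆ S → isIrreducibleZ C' → C ⊆ C' → C' = C }

/-- Dimension of a subset: its Krull dimension as a topological space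
(with the subspace Zariski topology). -/
def dimZ {N : ℕ} (S : Set (Matrix (Fin N) (Fin N) ℂ)) : WithBot ℕ∞ :=
  letI := mzar N
  topologicalKrullDim S


/-- `X̊_{τ−[m]}`: the matrix variety of the tableau obtained from `τ` by deleting its
rightmost entry equal to `m`, defined inside `(N−1) × (N−1)` matrices with respect to the
weight `μ' = (μ_1, …, μ_{m−1}, μ_m − 1)`. -/
def XcircMinus {m : ℕ} (μ lam : Fin m → ℕ) (N : ℕ) (T : Tableau m lam μ)
    (last : Fin m) : Set (Matrix (Fin (N - 1)) (Fin (N - 1)) ℂ) :=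
  { B | inSlice (Function.update μ last (μ last - 1)) B ∧ upperTri B ∧
      ∀ i : Fin m,
        hasType
          (corner B (off (Function.update μ last (μ last - 1)) i
            + Function.update μ last (μ last - 1) i)) m
          (if (i : ℕ) + 1 = m then shapeRowBox T m (μ last - 1)
           else shapeRow T ((i : ℕ) + 1)) }

/-- The standard basis vector of `ℂ^n` supported at (0-based) position `i`. -/
def stdVec (n : ℕ) (i : ℕ) : Fin n → ℂ := fun j => if (j : ℕ) = i then 1 else 0

/-- `L = span(e_1^{μ_1}, …, e_{m−1}^{μ_{m−1}})`. -/
def Lspan {m : ℕ} (μ : Fin m → ℕ) (n : ℕ) : Submodule ℂ (Fin n → ℂ) :=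
  Submodule.span ℂ
    { v | ∃ a : Fin m, (a : ℕ) + 1 < m ∧ v = stdVec n (off μ a + (μ a - 1)) }

/-- `S = (B^{l−1})^{-1}(Im B^{l})`. -/
def Ssub {n : ℕ} (B : Matrix (Fin n) (Fin n) ℂ) (l : ℕ) : Submodule ℂ (Fin n → ℂ) :=
  Submodule.comap (Matrix.mulVecLin (B ^ (l - 1)))
    (LinearMap.range (Matrix.mulVecLin (B ^ l)))


/-! ### Linear algebra -/

lemma finrank_Ssub_add_rank {n : ℕ} (B : Matrix (Fin n) (Fin n) ℂ) {l : ℕ} (hl : 1 ≤ l) :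
    Module.finrank ℂ ↥(Ssub B l) + (B ^ (l - 1)).rank = n + (B ^ l).rank := by
  obtain ⟨k, rfl⟩ : ∃ k, l = k + 1 := ⟨l - 1, by omega⟩
  simp only [Nat.add_sub_cancel]
  set f := Matrix.mulVecLin (B ^ k) with hf
  set p := LinearMap.range (Matrix.mulVecLin (B ^ (k + 1))) with hp
  have hple : p ≤ LinearMap.range f := by
    rintro _ ⟨u, rfl⟩
    exact ⟨B.mulVec u, by simp [hf, pow_succ, Matrix.mulVec_mulVec]⟩
  have hS : Ssub B (k + 1) = p.comap f := rfl
  have hker : LinearMap.ker f ≤ p.comap f := fun v hv => by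
    rw [Submodule.mem_comap, LinearMap.mem_ker.1 hv]; exact p.zero_mem
  have h1 := LinearMap.finrank_range_add_finrank_ker (f.domRestrict (p.comap f))
  have h2 : LinearMap.range (f.domRestrict (p.comap f)) = p := by
    rw [LinearMap.range_domRestrict, Submodule.map_comap_eq, inf_eq_right.2 hple]
  have h3 : Module.finrank ℂ (LinearMap.ker (f.domRestrict (p.comap f)))
      = Module.finrank ℂ (LinearMap.ker f) := by
    rw [LinearMap.ker_domRestrict]
    exact (Submodule.comapSubtypeEquivOfLe hker).finrank_eq
  have h4 := LinearMap.finrank_range_add_finrank_ker f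
  rw [Module.finrank_fin_fun] at h4
  rw [h2, h3] at h1
  rw [hS]
  change _ + Module.finrank ℂ (LinearMap.range f) = n + Module.finrank ℂ p
  omega

lemma corner_self {n : ℕ} (B : Matrix (Fin n) (Fin n) ℂ) : corner B n = B := by
  ext i j; simp [corner, ent]

/-- The inclusion of the first `d` coordinates intertwines a corner with the full matrix. -/
lemma upperTri.pow_mul_incl {n d : ℕ} (h : d ≤ n) {B : Matrix (Fin n) (Fin n) ℂ}
    (hB : upperTri B) (k : ℕ) :
    B ^ k * (1 : Matrix (Fin n) (Fin n) ℂ).submatrix id (Fin.castLE h)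
      = (1 : Matrix (Fin n) (Fin n) ℂ).submatrix id (Fin.castLE h) * corner B d ^ k := by
  set E := (1 : Matrix (Fin n) (Fin n) ℂ).submatrix id (Fin.castLE h) with hE
  have key : B * E = E * corner B d := by
    ext i j
    have h1 : (B * E) i j = B i (Fin.castLE h j) := by
      simp [hE, Matrix.mul_apply, Matrix.one_apply]
    rw [h1, Matrix.mul_apply]
    by_cases hi : (i : ℕ) < d
    · rw [Finset.sum_eq_single ⟨i, hi⟩]
      · have : ((j : ℕ) < n) := by omega
        simp [hE, Matrix.one_apply, corner, ent, this, Fin.castLE]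
      · intro b _ hb
        have : i ≠ Fin.castLE h b := fun e => hb (by ext; simp [e])
        simp [hE, this]
      · simp
    · rw [hB i _ (by simp; omega), Finset.sum_eq_zero]
      intro b _
      have : i ≠ Fin.castLE h b := fun e => hi (by simp [e])
      simp [hE, this]
  induction k with
  | zero => simp
  | succ k ih => rw [pow_succ, Matrix.mul_assoc, key, ← Matrix.mul_assoc, ih, Matrix.mul_assoc,
      ← pow_succ]

/-- If passing from a proper corner to the full matrix does not change the rank of the `k`-th
power, then the kernel of that power is not contained in any of the new coordinate hyperplanes. -/
lemma upperTri.exists_mem_ker {n d : ℕ} (h : d ≤ n) {B : Matrix (Fin n) (Fin n) ℂ}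
    (hB : upperTri B) {k : ℕ} (hr : (B ^ k).rank = (corner B d ^ k).rank)
    (i : Fin n) (hi : d ≤ i) :
    ∃ v : Fin n → ℂ, (B ^ k).mulVec v = 0 ∧ v i = 1 := by
  set E := (1 : Matrix (Fin n) (Fin n) ℂ).submatrix id (Fin.castLE h) with hE
  have hEv (u : Fin d → ℂ) (j : Fin d) : (E.mulVec u) (Fin.castLE h j) = u j := by
    simp [hE, Matrix.mulVec, dotProduct, Matrix.one_apply]
  have hEi (u : Fin d → ℂ) : E.mulVec u i = 0 := by
    change ∑ b, E i b * u b = 0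
    refine Finset.sum_eq_zero fun b _ => ?_
    have : i ≠ Fin.castLE h b := fun e => by
      have := congrArg Fin.val e
      simp at this; omega
    simp [hE, this]
  have hinj : Function.Injective (Matrix.mulVecLin E) := fun u u' huu => by
    ext j
    rw [← hEv u j, ← hEv u' j]
    exact congrFun huu _
  have hcomp : (Matrix.mulVecLin (B ^ k)).comp (Matrix.mulVecLin E)
      = (Matrix.mulVecLin E).comp (Matrix.mulVecLin (corner B d ^ k)) := by
    rw [← Matrix.mulVecLin_mul, ← Matrix.mulVecLin_mul, hB.pow_mul_incl h k]
  have hrange : LinearMap.range ((Matrix.mulVecLin (B ^ k)).comp (Matrix.mulVecLin E))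
      = LinearMap.range (Matrix.mulVecLin (B ^ k)) := by
    refine Submodule.eq_of_le_of_finrank_eq (LinearMap.range_comp_le_range _ _) ?_
    rw [hcomp, LinearMap.range_comp,
      ← (Submodule.equivMapOfInjective _ hinj _).finrank_eq]
    exact hr.symm
  obtain ⟨u, hu⟩ : (Matrix.mulVecLin (B ^ k)) (Pi.single i 1) ∈
      LinearMap.range ((Matrix.mulVecLin (B ^ k)).comp (Matrix.mulVecLin E)) :=
    hrange ▸ LinearMap.mem_range_self _ _
  refine ⟨Pi.single i 1 - E.mulVec u, ?_, by simp [hEi]⟩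
  rw [Matrix.mulVec_sub, sub_eq_zero]
  exact hu.symm

/-- The last row of a nilpotent upper triangular matrix vanishes. -/
lemma upperTri.last_row_eq_zero {n : ℕ} {B : Matrix (Fin n) (Fin n) ℂ} (hB : upperTri B)
    {k : ℕ} (hk : B ^ k = 0) (i : Fin n) (hi : (i : ℕ) + 1 = n) (j : Fin n) : B i j = 0 := by
  rcases lt_or_eq_of_le (show (j : ℕ) ≤ i by omega) with hj | hj
  · exact hB i j hj
  · obtain rfl : j = i := Fin.ext hj
    have hrow (q : ℕ) : (B ^ q) j j = B j j ^ q := by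
      induction q with
      | zero => simp
      | succ q ih =>
        rw [pow_succ', Matrix.mul_apply, Finset.sum_eq_single j, ih, pow_succ']
        · intro b _ hb
          rw [hB j b (by have : (b : ℕ) ≠ j := fun e => hb (Fin.ext e)
                         omega), zero_mul]
        · simp
    have := hrow k
    rw [hk] at this
    exact eq_zero_of_pow_eq_zero this.symm

/-! ### Blocks -/

lemma off_eq_sum_range {m : ℕ} (μ : Fin m → ℕ) (a : Fin m) :
    off μ a = ∑ j ∈ Finset.range a, ext μ j := by
  have h := Fin.sum_univ_eq_sum_range (fun j => if j < (a : ℕ) then ext μ j else 0) m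
  have hf : (Finset.range m).filter (fun j => j < (a : ℕ)) = Finset.range a := by
    ext j
    simp only [Finset.mem_filter, Finset.mem_range]
    omega
  rw [off, ← hf, Finset.sum_filter, Finset.sum_filter]
  convert h using 3
  simp [ext]

lemma off_add_self {m : ℕ} (μ : Fin m → ℕ) (a : Fin m) :
    off μ a + μ a = ∑ j ∈ Finset.range (a + 1), ext μ j := by
  rw [off_eq_sum_range, Finset.sum_range_succ]
  simp [ext]

lemma sum_eq_sum_range_ext {m : ℕ} (μ : Fin m → ℕ) :
    ∑ j, μ j = ∑ j ∈ Finset.range m, ext μ j := by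
  rw [← Fin.sum_univ_eq_sum_range]
  simp [ext]

lemma off_add_le_off {m : ℕ} (μ : Fin m → ℕ) {a b : Fin m} (h : a < b) :
    off μ a + μ a ≤ off μ b := by
  rw [off_add_self, off_eq_sum_range]
  exact Finset.sum_le_sum_of_subset (Finset.range_subset_range.2 h)

lemma off_add_last {m : ℕ} (μ : Fin m → ℕ) (a : Fin m) (ha : (a : ℕ) + 1 = m) :
    off μ a + μ a = ∑ j, μ j := by
  rw [off_add_self, sum_eq_sum_range_ext, ha]

lemma off_update_last {m : ℕ} (μ : Fin m → ℕ) (a last : Fin m) (ha : (last : ℕ) + 1 = m) (x : ℕ) :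
    off (Function.update μ last x) a = off μ a := by
  refine Finset.sum_congr rfl fun j hj => Function.update_of_ne ?_ _ _
  rintro rfl
  have := (Finset.mem_filter.1 hj).2
  omega

lemma exists_eq_off_add {m : ℕ} (μ : Fin m → ℕ) {i : ℕ} (hi : i < ∑ j, μ j) :
    ∃ a : Fin m, ∃ b < μ a, i = off μ a + b := by
  have key : ∀ k ≤ m, i < ∑ j ∈ Finset.range k, ext μ j → ∃ a : Fin m, ∃ b < μ a, i = off μ a + b := by
    intro k
    induction k with
    | zero => simp
    | succ k ih =>
      intro hk h
      by_cases h' : i < ∑ j ∈ Finset.range k, ext μ j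
      · exact ih (by omega) h'
      · have h1 := off_add_self μ ⟨k, hk⟩
        have h2 := off_eq_sum_range μ ⟨k, hk⟩
        simp only at h1 h2
        exact ⟨⟨k, hk⟩, i - off μ ⟨k, hk⟩, by omega, by omega⟩
  exact key m le_rfl (sum_eq_sum_range_ext μ ▸ hi)

/-- A row vector annihilating the image of a slice matrix and the ends of all blocks but the last
is supported at the end of the last block. -/
lemma inSlice.eq_zero_of_vecMul {m n : ℕ} {ν : Fin m → ℕ} (hn : ∑ j, ν j = n)
    {last : Fin m} (hlast : (last : ℕ) + 1 = m)
    {B : Matrix (Fin n) (Fin n) ℂ} (hB : inSlice ν B)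
    (hrow : ∀ i : Fin n, (i : ℕ) + 1 = n → ∀ j, B i j = 0) {w : Fin n → ℂ}
    (hw : ∀ j, ∑ i, w i * B i j = 0)
    (hL : ∀ (a : Fin m) (i : Fin n), (a : ℕ) + 1 < m → (i : ℕ) = off ν a + (ν a - 1) → w i = 0)
    (i : Fin n) (hi : (i : ℕ) + 1 ≠ n ∨ ν last = 0) : w i = 0 := by
  have hend := off_add_last ν last hlast
  obtain ⟨a, b, hb, hab⟩ := exists_eq_off_add ν (i.2.trans_eq hn.symm)
  have hnl (s : Fin m) (hs : s ≠ last) : (s : ℕ) + 1 < m := by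
    have : (s : ℕ) ≠ last := fun e => hs (Fin.ext e)
    omega
  by_cases hb1 : b + 1 = ν a
  · by_cases ha : a = last
    · subst ha; omega
    · exact hL a i (hnl a ha) (by omega)
  · have hj : (i : ℕ) + 1 < n := by
      by_cases ha : a = last
      · subst ha; omega
      · have := off_add_le_off ν (show a < last from by
          have := hnl a ha
          rw [Fin.lt_def]; omega)
        omega
    have h := hw ⟨i + 1, hj⟩
    rw [Finset.sum_eq_single i] at h
    · have hs := hB a a b (b + 1) hb (by omega) (Or.inl (by omega))
      rw [Jent, if_pos ⟨a, b, by omega, rfl, by omega⟩, ← add_assoc, ← hab] at hs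
      rw [ent, dif_pos ⟨i.2, hj⟩] at hs
      rwa [hs, mul_one] at h
    · intro i' _ hne
      obtain ⟨s, t, ht, hst⟩ := exists_eq_off_add ν (i'.2.trans_eq hn.symm)
      by_cases ht1 : t + 1 = ν s
      · by_cases hs : s = last
        · subst hs
          rw [hrow i' (by omega), mul_zero]
        · rw [hL s i' (hnl s hs) (by omega), zero_mul]
      · have hs := hB s a t (b + 1) ht (by omega) (Or.inl (by omega))
        rw [Jent, if_neg, ← add_assoc, ← hab, ← hst, ent, dif_pos ⟨i'.2, hj⟩] at hs
        · rw [hs, mul_zero]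
        · rintro ⟨a', b', -, h1, h2⟩
          exact hne (Fin.ext (by omega))
    · simp

lemma finrank_Lspan {m n : ℕ} (μ : Fin m → ℕ) (hμ : ∀ i, 1 ≤ μ i) (hm : 1 ≤ m)
    (hn : ∀ a : Fin m, (a : ℕ) + 1 < m → off μ a + μ a ≤ n) :
    Module.finrank ℂ ↥(Lspan μ n) = m - 1 := by
  let pos : Fin (m - 1) → Fin n := fun a =>
    ⟨off μ ⟨a, by omega⟩ + (μ ⟨a, by omega⟩ - 1), by
      have := hn ⟨a, by omega⟩ (by simp; omega)
      have := hμ ⟨a, by omega⟩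
      omega⟩
  have hpos : StrictMono pos := fun a b hab => by
    have h1 := off_add_le_off μ (a := ⟨a, by omega⟩) (b := ⟨b, by omega⟩) hab
    have := hμ ⟨a, by omega⟩
    rw [Fin.lt_def]
    simp only [pos]
    omega
  have hli := (Pi.basisFun ℂ (Fin n)).linearIndependent.comp pos hpos.injective
  have hspan : Lspan μ n = Submodule.span ℂ (Set.range (Pi.basisFun ℂ (Fin n) ∘ pos)) := by
    unfold Lspan
    congr 1
    have hstd (a : Fin (m - 1)) : stdVec n (off μ ⟨a, by omega⟩ + (μ ⟨a, by omega⟩ - 1))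
        = Pi.basisFun ℂ (Fin n) (pos a) := by
      ext j
      simp [stdVec, pos, Pi.single_apply, Fin.ext_iff]
    ext v
    constructor
    · rintro ⟨a, ha, rfl⟩
      exact ⟨⟨a, by omega⟩, (hstd ⟨a, by omega⟩).symm⟩
    · rintro ⟨a, rfl⟩
      exact ⟨⟨a, by omega⟩, by simp; omega, (hstd a).symm⟩
  rw [hspan, finrank_span_eq_card hli, Fintype.card_fin]

/-! ### Tableaux -/

section Tableau

variable {m : ℕ} {lam μ : Fin m → ℕ} (T : Tableau m lam μ)

lemma lt_of_lt_ext {f : Fin m → ℕ} {s c : ℕ} (h : c < ext f s) : s < m := by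
  by_contra hs
  simp [ext, hs] at h

lemma shapeRow_le_ext (i s : ℕ) : shapeRow T i s ≤ ext lam s :=
  (Finset.card_filter_le _ _).trans (Finset.card_range _).le

lemma shapeRow_add_card (s : ℕ) :
    shapeRow T (m - 1) s + ((Finset.range (ext lam s)).filter fun c => T.entry s c = m).card
      = ext lam s := by
  have h := Finset.card_filter_add_card_filter_not (s := Finset.range (ext lam s))
    (fun c => 1 ≤ T.entry s c ∧ T.entry s c ≤ m - 1)
  rw [Finset.card_range] at h
  refine Eq.trans ?_ h
  unfold shapeRow
  congr 2
  ext c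
  simp only [Finset.mem_filter, Finset.mem_range, and_congr_right_iff]
  intro hc
  have h1 := T.entry_pos s c hc
  have h2 := T.entry_le s c hc
  omega

lemma sum_shapeRow_add (last : Fin m) (hlast : (last : ℕ) + 1 = m) :
    ∑ s ∈ Finset.range m, shapeRow T (m - 1) s + μ last = ∑ j, lam j := by
  rw [sum_eq_sum_range_ext, ← T.weight last, hlast, ← Finset.sum_add_distrib]
  exact Finset.sum_congr rfl fun s _ => shapeRow_add_card T s

/-- The box removed by `shapeRowBox` is the end of its row and lies in the rightmost column
containing an entry `m`. -/
lemma entry_lt_of_removed {last : Fin m} (hlast : (last : ℕ) + 1 = m) {ρ : ℕ}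
    (h : shapeRowBox T m (μ last - 1) ρ < ext lam ρ) :
    1 ≤ ext lam ρ ∧ T.entry ρ (ext lam ρ - 1) = m ∧
      ∀ s c, c < ext lam s → T.entry s c = m → c < ext lam ρ := by
  obtain ⟨c₀, hc₀, hp⟩ : ∃ c₀ < ext lam ρ, ¬ ((1 ≤ T.entry ρ c₀ ∧ T.entry ρ c₀ < m) ∨
      (T.entry ρ c₀ = m ∧ ((Finset.range c₀).filter
        fun c' => ∃ r' < m, T.entry r' c' = m).card < μ last - 1)) := by
    by_contra! hcon
    refine h.ne ?_
    rw [shapeRowBox, Finset.filter_true_of_mem fun c hc => hcon c (Finset.mem_range.1 hc),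
      Finset.card_range]
  have h1 := T.entry_pos ρ c₀ hc₀
  have h2 := T.entry_le ρ c₀ hc₀
  have hm : T.entry ρ c₀ = m := by omega
  refine ⟨by omega, le_antisymm (T.entry_le _ _ (by omega))
    (hm.ge.trans <| T.row_weak ρ c₀ _ (by omega) (by omega)), fun s c hc hsc => ?_⟩
  by_contra! hlt
  set P := (Finset.range c₀).filter fun c' => ∃ r' < m, T.entry r' c' = m with hP
  set U := (Finset.range m).biUnion
    fun r' => (Finset.range (ext lam r')).filter fun c' => T.entry r' c' = m with hU
  have hUcard : U.card ≤ μ last := by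
    rw [← T.weight last, hlast]
    exact Finset.card_biUnion_le
  have hmem (r' c' : ℕ) (he : T.entry r' c' = m) : c' ∈ U := by
    have hlt : c' < ext lam r' := by
      by_contra hz
      have := T.zeros r' c' hz
      omega
    simp only [hU, Finset.mem_biUnion, Finset.mem_filter, Finset.mem_range]
    exact ⟨r', lt_of_lt_ext hlt, hlt, he⟩
  have hsub : insert c (insert c₀ P) ⊆ U := by
    intro x hx
    simp only [Finset.mem_insert, hP, Finset.mem_filter] at hx
    rcases hx with rfl | rfl | ⟨-, r', -, hr'⟩
    · exact hmem _ _ hsc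
    · exact hmem _ _ hm
    · exact hmem _ _ hr'
  have hcard := Finset.card_le_card hsub
  rw [Finset.card_insert_of_notMem, Finset.card_insert_of_notMem] at hcard
  · omega
  · simp [hP]
  · simp only [hP, Finset.mem_insert, Finset.mem_filter, Finset.mem_range]
    omega

/-- Removing the rightmost entry `m` from the end of row `ρ` leaves a shape that agrees with the
shape of the entries smaller than `m` from column `ext lam ρ - 1` (0-based) on. -/
lemma shapeRowBox_sub_eq {last : Fin m} (hlast : (last : ℕ) + 1 = m) {ρ : ℕ}
    (hrow : shapeRowBox T m (μ last - 1) ρ + 1 = ext lam ρ)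
    (hother : ∀ s, s ≠ ρ → shapeRowBox T m (μ last - 1) s = ext lam s) (s : ℕ) :
    shapeRowBox T m (μ last - 1) s - (ext lam ρ - 1)
      = shapeRow T (m - 1) s - (ext lam ρ - 1) := by
  obtain ⟨hpos, hend, hmax⟩ := entry_lt_of_removed T hlast (show _ < ext lam ρ by omega)
  have hadd := shapeRow_add_card T s
  by_cases hs : s = ρ
  · subst hs
    have : 0 < ((Finset.range (ext lam s)).filter fun c => T.entry s c = m).card :=
      Finset.card_pos.2 ⟨_, Finset.mem_filter.2 ⟨Finset.mem_range.2 (by omega), hend⟩⟩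
    omega
  rw [hother s hs]
  rcases Nat.eq_zero_or_pos
    ((Finset.range (ext lam s)).filter fun c => T.entry s c = m).card with h0 | h0
  · omega
  obtain ⟨c, hc⟩ := Finset.card_pos.1 h0
  obtain ⟨hc, hcm⟩ := Finset.mem_filter.1 hc
  rw [Finset.mem_range] at hc
  have he : T.entry s (ext lam s - 1) = m := le_antisymm (T.entry_le _ _ (by omega))
    (hcm.ge.trans <| T.row_weak s c _ (by omega) (by omega))
  have h1 := hmax s _ (by omega) he
  have hne : ext lam s ≠ ext lam ρ := by
    intro e
    rcases lt_or_gt_of_ne hs with h | h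
    · have := T.col_strict s ρ (ext lam ρ - 1) h (by omega)
      rw [e] at he; omega
    · have := T.col_strict ρ s (ext lam ρ - 1) h (by omega)
      rw [e] at he; omega
  omega

/-- Exactly the rows above `ρ` of the shape without its corner at the end of row `ρ` have
at least `ext lam ρ` boxes. -/
lemma sum_shapeRowBox_sub {last : Fin m} (hlast : (last : ℕ) + 1 = m)
    (hlam : ∀ i j : Fin m, i ≤ j → lam j ≤ lam i) {ρ : ℕ} (hρ : ρ < m)
    (hrow : shapeRowBox T m (μ last - 1) ρ + 1 = ext lam ρ)
    (hother : ∀ s, s ≠ ρ → shapeRowBox T m (μ last - 1) s = ext lam s) :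
    ∑ s ∈ Finset.range m, (shapeRowBox T m (μ last - 1) s - (ext lam ρ - 1))
      = ∑ s ∈ Finset.range m, (shapeRowBox T m (μ last - 1) s - ext lam ρ) + ρ := by
  obtain ⟨hpos, hend, -⟩ := entry_lt_of_removed T hlast (show _ < ext lam ρ by omega)
  have hcount : ∑ s ∈ Finset.range m, (if s < ρ then 1 else 0) = ρ := by
    rw [← Finset.sum_filter, ← Finset.card_eq_sum_ones]
    convert Finset.card_range ρ using 2
    ext s
    simp only [Finset.mem_filter, Finset.mem_range]
    omega
  refine Eq.trans ?_ (congrArg (_ + ·) hcount)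
  rw [← Finset.sum_add_distrib]
  refine Finset.sum_congr rfl fun s hs => ?_
  rw [Finset.mem_range] at hs
  rcases lt_trichotomy s ρ with h | rfl | h
  · have : ext lam ρ ≤ ext lam s := by
      simpa [ext, hs, hρ] using hlam ⟨s, hs⟩ ⟨ρ, hρ⟩ h.le
    rw [hother s h.ne, if_pos h]
    omega
  · simp only [lt_irrefl, if_false]
    omega
  · have : ext lam s < ext lam ρ := by
      by_contra! hle
      have h1 := T.col_strict ρ s (ext lam ρ - 1) h (by omega)
      have h2 := T.entry_le s (ext lam ρ - 1) (by omega)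
      omega
    rw [hother s h.ne', if_neg h.not_gt]
    omega

end Tableau

lemma hasType.rank_pow {n : ℕ} {A : Matrix (Fin n) (Fin n) ℂ} {rows : ℕ} {κ : ℕ → ℕ}
    (h : hasType A rows κ) (hn : ∑ s ∈ Finset.range rows, κ s = n) (k : ℕ) :
    (A ^ k).rank = ∑ s ∈ Finset.range rows, (κ s - k) := by
  rcases Nat.eq_zero_or_pos k with rfl | hk
  · simp [hn]
  · exact h k hk

lemma hasType.exists_pow_eq_zero {n : ℕ} {A : Matrix (Fin n) (Fin n) ℂ} {rows : ℕ} {κ : ℕ → ℕ}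
    (h : hasType A rows κ) : ∃ k, A ^ k = 0 := by
  refine ⟨∑ s ∈ Finset.range rows, κ s + 1, ?_⟩
  have hrank : (A ^ (∑ s ∈ Finset.range rows, κ s + 1)).rank = 0 := by
    rw [h _ (by omega)]
    refine Finset.sum_eq_zero fun s hs => ?_
    have := Finset.single_le_sum (f := κ) (fun _ _ => Nat.zero_le _) hs
    omega
  rw [Matrix.rank, Submodule.finrank_eq_zero, LinearMap.range_eq_bot] at hrank
  exact Matrix.toLin'.injective (hrank.trans (map_zero Matrix.toLin').symm)

/-- Criterion for `S` and `L` to span the whole space. -/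
lemma Ssub_sup_Lspan_eq_top {m n : ℕ} {μ : Fin m → ℕ} {last : Fin m}
    (hlast : (last : ℕ) + 1 = m) {x : ℕ} (hn : ∑ j, Function.update μ last x j = n)
    {B : Matrix (Fin n) (Fin n) ℂ} (hB : inSlice (Function.update μ last x) B)
    (hrow : ∀ i : Fin n, (i : ℕ) + 1 = n → ∀ j, B i j = 0) {l : ℕ} (hl : 1 ≤ l)
    (hker : x ≠ 0 → ∀ i : Fin n, (i : ℕ) + 1 = n →
      ∃ v : Fin n → ℂ, (B ^ (l - 1)).mulVec v = 0 ∧ v i = 1) :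
    Ssub B l ⊔ Lspan μ n = ⊤ := by
  by_contra hne
  obtain ⟨f, hf0, hf⟩ := Submodule.exists_le_ker_of_lt_top _ (lt_top_iff_ne_top.2 hne)
  set w : Fin n → ℂ := fun i => f (Pi.single i 1) with hw
  have hfw (v : Fin n → ℂ) : f v = ∑ i, w i * v i := by
    rw [LinearMap.pi_apply_eq_sum_univ f v]
    refine Finset.sum_congr rfl fun i _ => ?_
    rw [smul_eq_mul, mul_comm, hw]
    congr 2
    ext j
    simp [Pi.single_apply, eq_comm]
  have hS (v : Fin n → ℂ) (hv : v ∈ Ssub B l) : f v = 0 := hf (Submodule.mem_sup_left hv)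
  have hL (v : Fin n → ℂ) (hv : v ∈ Lspan μ n) : f v = 0 := hf (Submodule.mem_sup_right hv)
  have hzero := hB.eq_zero_of_vecMul hn hlast hrow (w := w)
    (fun j => by
      rw [← hfw]
      refine hS _ ⟨Pi.single j 1, ?_⟩
      obtain ⟨k, rfl⟩ : ∃ k, l = k + 1 := ⟨l - 1, by omega⟩
      rw [Nat.add_sub_cancel, pow_succ, Matrix.mulVecLin_mul, LinearMap.comp_apply]
      congr 1
      ext i
      simp)
    (fun a i ha hi => by
      have hal : a ≠ last := by rintro rfl; omega
      rw [off_update_last _ _ _ hlast, Function.update_of_ne hal] at hi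
      refine hL _ (Submodule.subset_span ⟨a, ha, ?_⟩)
      ext j
      simp [stdVec, Pi.single_apply, Fin.ext_iff, hi])
  rw [Function.update_self] at hzero
  refine hf0 (LinearMap.ext fun v => ?_)
  rw [hfw]
  refine Finset.sum_eq_zero fun i _ => ?_
  by_cases hi : (i : ℕ) + 1 ≠ n ∨ x = 0
  · rw [hzero i hi, zero_mul]
  · push Not at hi
    obtain ⟨u, hu, hui⟩ := hker hi.2 i hi.1
    have h1 := hfw u
    rw [hS u (show u ∈ Ssub B l from ⟨0, by simp [hu]⟩), Finset.sum_eq_single i, hui, mul_one] at h1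
    · rw [← h1, zero_mul]
    · intro j _ hj
      have : (j : ℕ) ≠ i := fun e => hj (Fin.ext e)
      rw [hzero j (Or.inl (by omega)), zero_mul]
    · simp


/-- With `S = (B^{λ_r−1})^{-1}(Im B^{λ_r})` and
`L = span(e_1^{μ_1}, …, e_{m−1}^{μ_{m−1}})`, we have `dim S = N − r` and
`dim (S ∩ L) = m − r`. -/
theorem stmt7 (m : ℕ) (hm : 1 ≤ m) (μ : Fin m → ℕ)
    (hμmono : ∀ i j : Fin m, i ≤ j → μ j ≤ μ i) (hμpos : ∀ i : Fin m, 1 ≤ μ i)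
    (N : ℕ) (hN : N = ∑ j, μ j)
    (lam : Fin m → ℕ) (hlammono : ∀ i j : Fin m, i ≤ j → lam j ≤ lam i)
    (hlamsum : ∑ j, lam j = N)
    (T : Tableau m lam μ)
    (r : ℕ) (hr1 : 1 ≤ r) (hrm : r ≤ m)
    (hrow : shapeRowBox T m (μ ⟨m - 1, by omega⟩ - 1) (r - 1) + 1 = ext lam (r - 1))
    (hother : ∀ s : ℕ, s ≠ r - 1 →
      shapeRowBox T m (μ ⟨m - 1, by omega⟩ - 1) s = ext lam s)
    (B : Matrix (Fin (N - 1)) (Fin (N - 1)) ℂ)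
    (hB : B ∈ XcircMinus μ lam N T ⟨m - 1, by omega⟩) :
    Module.finrank ℂ ↥(Ssub B (ext lam (r - 1))) = N - r ∧
    Module.finrank ℂ ↥(Ssub B (ext lam (r - 1)) ⊓ Lspan μ (N - 1)) = m - r := by
  set last : Fin m := ⟨m - 1, by omega⟩ with hlast_def
  have hlast : (last : ℕ) + 1 = m := by simp [hlast_def]; omega
  obtain ⟨hslice, hupper, htype⟩ := hB
  set ν := Function.update μ last (μ last - 1) with hν
  have hμl := hμpos last
  have hoff := off_add_last μ last hlast
  have hνoff : off ν last = off μ last := off_update_last μ last last hlast _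
  have hνend := off_add_last ν last hlast
  have hνlast : ν last = μ last - 1 := Function.update_self ..
  have hνsum : ∑ j, ν j = N - 1 := by omega
  have hsum : ∑ s ∈ Finset.range m, shapeRowBox T m (μ last - 1) s = N - 1 := by
    have h : ∑ s ∈ Finset.range m, shapeRowBox T m (μ last - 1) s + 1
        = ∑ s ∈ Finset.range m, ext lam s := by
      have hmem : r - 1 ∈ Finset.range m := Finset.mem_range.2 (by omega)
      have hrest : ∑ s ∈ (Finset.range m).erase (r - 1), shapeRowBox T m (μ last - 1) s
          = ∑ s ∈ (Finset.range m).erase (r - 1), ext lam s :=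
        Finset.sum_congr rfl fun s hs => hother s (Finset.ne_of_mem_erase hs)
      rw [← Finset.add_sum_erase _ _ hmem, ← Finset.add_sum_erase _ (fun s => ext lam s) hmem,
        ← hrow, hrest]
      omega
    rw [← sum_eq_sum_range_ext, hlamsum] at h
    omega
  have hBtype : hasType B m (shapeRowBox T m (μ last - 1)) := by
    have h := htype last
    rw [if_pos hlast, hνend, hνsum, corner_self] at h
    exact h
  have hCsum : ∑ s ∈ Finset.range m, shapeRow T (m - 1) s = off μ last := by
    have := sum_shapeRow_add T last hlast
    omega
  have hCtype : hasType (corner B (off μ last)) m (shapeRow T (m - 1)) := by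
    by_cases hm1 : m = 1
    · have h0 : off μ last = 0 := by
        rw [off_eq_sum_range, show (last : ℕ) = 0 by omega, Finset.sum_range_zero]
      intro k hk
      have hle := ((corner B (off μ last)) ^ k).rank_le_width
      have := Finset.sum_le_sum (s := Finset.range m)
        fun s _ => Nat.sub_le (shapeRow T (m - 1) s) k
      omega
    · let a : Fin m := ⟨m - 2, by omega⟩
      have h := htype a
      have ha : off ν a + ν a = off μ last := by
        rw [off_add_self, ← hνoff, off_eq_sum_range]
        congr 2
        simp only [a]
        omega
      have ha1 : (a : ℕ) + 1 = m - 1 := by simp only [a]; omega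
      rwa [if_neg (by omega), ha, ha1] at h
  have hBrank := hBtype.rank_pow hsum
  have hmN : m ≤ N := by
    rw [hN]
    calc m = ∑ _j : Fin m, 1 := by simp
      _ ≤ _ := Finset.sum_le_sum fun j _ => hμpos j
  set l := ext lam (r - 1) with hl
  have hl1 : 1 ≤ l := by omega
  have hdim : Module.finrank ℂ ↥(Ssub B l) = N - r := by
    have h1 := finrank_Ssub_add_rank B hl1
    have h2 := sum_shapeRowBox_sub T hlast hlammono (show r - 1 < m by omega) hrow hother
    rw [← hl] at h2
    rw [hBrank, hBrank] at h1
    omega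
  refine ⟨hdim, ?_⟩
  obtain ⟨k, hk⟩ := hBtype.exists_pow_eq_zero
  have htop : Ssub B l ⊔ Lspan μ (N - 1) = ⊤ := by
    refine Ssub_sup_Lspan_eq_top hlast hνsum hslice (hupper.last_row_eq_zero hk) hl1 ?_
    intro hx i hi
    refine hupper.exists_mem_ker (d := off μ last) (by omega) ?_ i (by omega)
    rw [hBrank, hCtype.rank_pow hCsum]
    exact Finset.sum_congr rfl fun s _ => shapeRowBox_sub_eq T hlast hrow hother s
  have hLdim := finrank_Lspan (n := N - 1) μ hμpos hm fun a ha => by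
    have := off_add_le_off μ (show a < last from by rw [Fin.lt_def]; omega)
    omega
  have h := Submodule.finrank_sup_add_finrank_inf_eq (Ssub B l) (Lspan μ (N - 1))
  rw [htop, finrank_top, Module.finrank_fin_fun, hdim, hLdim] at h
  omega

end Gov
end
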